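/- Fix any c ∈ [0,1] and dimension d ≥ 2. There exist a radius R > 0, a unit vector θ* ∈ ℝ^d, and a unit vector θ̃ ∈ ℝ^d with angle πc to θ*, such that with 𝕏 the uniform distribution on the sphere of radius R in ℝ^d, the clean distribution ℙ labeling x by sign(θ*·x), and the noisy distribution 𝔻 labeling x by y_adv(x) = sign(θ̃·x), the following hold: (1) the x-marginals of ℙ and 𝔻 coincide with 𝕏; (2) the noise level is Pr_{(x,y_adv)∼𝔻}[y_adv ≠ sign(θ*·x)] = c; and (3) any minimizer θ̂ of the naive objective R_naive(θ) = E_{(x,y_adv)∼𝔻}[log(1 + e^{−y_adv θ·x})] over the unit ball {‖θ‖₂ ≤ 1} has clean risk R(θ̂) ≥ min_{‖θ‖₂ ≤ 1} R(θ) + c/2, where R(θ) = E_{x∼𝕏}[log(1 + e^{−sign(θ*·x) θ·x})]. -/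

import Mathlib

open MeasureTheory RealInnerProductSpace

/-- A `{±1}`-valued sign function. -/
noncomputable def sgn (t : ℝ) : ℝ := if 0 < t then 1 else -1

lemma measurable_sgn : Measurable sgn := by
  unfold sgn
  exact Measurable.ite measurableSet_Ioi measurable_const measurable_const

lemma sgn_mul_self (t : ℝ) : sgn t * t = |t| := by
  unfold sgn
  split_ifs with h
  · rw [abs_of_pos h]; ring
  · rw [abs_of_nonpos (not_lt.1 h)]; ring

lemma sgn_cases (t : ℝ) : sgn t = 1 ∨ sgn t = -1 := by
  unfold sgn
  split_ifs <;> simp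

lemma abs_sgn (t : ℝ) : |sgn t| = 1 := by
  rcases sgn_cases t with h | h <;> simp [h]

section inv
variable {d : ℕ}

lemma law_eq (X : Measure (EuclideanSpace ℝ (Fin d)))
    (hX : ∀ T : EuclideanSpace ℝ (Fin d) ≃ₗᵢ[ℝ] EuclideanSpace ℝ (Fin d), X.map T = X)
    (v w : EuclideanSpace ℝ (Fin d)) (h : ‖v‖ = ‖w‖) :
    X.map (fun x => ⟪v, x⟫) = X.map (fun x => ⟪w, x⟫) := by
  set T := (ℝ ∙ (v - w))ᗮ.reflection with hT
  have hTv : T v = w := Submodule.reflection_sub h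
  have hc : ∀ x, ⟪v, T x⟫ = ⟪w, x⟫ := by
    intro x
    rw [← hTv, ← T.inner_map_map v (T x)]
    congr 1
    exact Submodule.reflection_reflection _ x
  conv_lhs => rw [← hX T]
  rw [Measure.map_map (by fun_prop) T.continuous.measurable]
  congr 1
  funext x
  exact hc x

lemma law_set (X : Measure (EuclideanSpace ℝ (Fin d)))
    (hX : ∀ T : EuclideanSpace ℝ (Fin d) ≃ₗᵢ[ℝ] EuclideanSpace ℝ (Fin d), X.map T = X)
    (v w : EuclideanSpace ℝ (Fin d)) (h : ‖v‖ = ‖w‖) {s : Set ℝ} (hs : MeasurableSet s) :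
    X {x | ⟪v, x⟫ ∈ s} = X {x | ⟪w, x⟫ ∈ s} := by
  have h1 := congrArg (fun m => m s) (law_eq X hX v w h)
  rw [Measure.map_apply (by fun_prop) hs, Measure.map_apply (by fun_prop) hs] at h1
  exact h1

lemma law_int (X : Measure (EuclideanSpace ℝ (Fin d)))
    (hX : ∀ T : EuclideanSpace ℝ (Fin d) ≃ₗᵢ[ℝ] EuclideanSpace ℝ (Fin d), X.map T = X)
    (v w : EuclideanSpace ℝ (Fin d)) (h : ‖v‖ = ‖w‖) {f : ℝ → ℝ} (hf : Measurable f) :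
    ∫ x, f ⟪v, x⟫ ∂X = ∫ x, f ⟪w, x⟫ ∂X := by
  have h1 := congrArg (fun m => ∫ t, f t ∂m) (law_eq X hX v w h)
  rw [integral_map (by fun_prop) hf.aestronglyMeasurable,
    integral_map (by fun_prop) hf.aestronglyMeasurable] at h1
  exact h1

/-- volume on the unit ball -/
noncomputable def bm (d : ℕ) : Measure (EuclideanSpace ℝ (Fin d)) :=
  volume.restrict (Metric.ball 0 1)

lemma bm_inv (T : EuclideanSpace ℝ (Fin d) ≃ₗᵢ[ℝ] EuclideanSpace ℝ (Fin d)) :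
    (bm d).map T = bm d := by
  have h := (T.measurePreserving).restrict_preimage (s := Metric.ball 0 1)
    Metric.isOpen_ball.measurableSet
  have h2 : T ⁻¹' (Metric.ball 0 1) = Metric.ball 0 1 := by
    ext x; simp
  rw [h2] at h
  exact h.map_eq

instance bm_fin : IsFiniteMeasure (bm d) := by
  unfold bm
  exact ⟨by simpa using measure_ball_lt_top⟩

lemma bm_pos : 0 < bm d Set.univ := by
  unfold bm
  simpa using Metric.measure_ball_pos volume (0 : EuclideanSpace ℝ (Fin d)) one_pos

lemma bm_slab (e : EuclideanSpace ℝ (Fin d)) (he : ‖e‖ = 1) (ε : ENNReal) (hε : 0 < ε) :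
    ∃ δ : ℝ, 0 < δ ∧ bm d {w | |⟪e, w⟫| ≤ δ} ≤ ε := by
  have hnull : bm d {w | ⟪e, w⟫ = 0} = 0 := by
    have h1 : (volume : Measure (EuclideanSpace ℝ (Fin d))) ((ℝ ∙ e)ᗮ : Submodule ℝ _) = 0 := by
      apply Measure.addHaar_submodule
      intro h
      have : e ∈ (ℝ ∙ e)ᗮ := by rw [h]; trivial
      rw [Submodule.mem_orthogonal_singleton_iff_inner_right] at this
      rw [real_inner_self_eq_norm_sq, he] at this
      norm_num at this
    have h2 : {w | ⟪e, w⟫ = 0} = (((ℝ ∙ e)ᗮ : Submodule ℝ _) : Set (EuclideanSpace ℝ (Fin d))) := by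
      ext w
      simp [Submodule.mem_orthogonal_singleton_iff_inner_right]
    rw [h2]
    exact le_antisymm ((Measure.restrict_apply_le _ _).trans h1.le) (zero_le)
  have hanti : Antitone (fun n : ℕ => {w : EuclideanSpace ℝ (Fin d) | |⟪e, w⟫| ≤ 1 / ((n : ℝ) + 1)}) := by
    intro m n hmn w hw
    simp only [Set.mem_ofPred_eq] at hw ⊢
    refine hw.trans ?_
    exact Nat.one_div_le_one_div hmn
  have hI : (⋂ n : ℕ, {w : EuclideanSpace ℝ (Fin d) | |⟪e, w⟫| ≤ 1 / ((n : ℝ) + 1)}) = {w | ⟪e, w⟫ = 0} := by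
    ext w
    simp only [Set.mem_iInter, Set.mem_ofPred_eq]
    constructor
    · intro h
      have := ge_of_tendsto' tendsto_one_div_add_atTop_nhds_zero_nat h
      simpa using this
    · intro h n
      rw [h, abs_zero]
      positivity
  have ht := tendsto_measure_iInter_atTop (μ := bm d) (s := fun n : ℕ => {w : EuclideanSpace ℝ (Fin d) | |⟪e, w⟫| ≤ 1 / ((n : ℝ) + 1)})
    (fun n => (measurableSet_le (by fun_prop) (by fun_prop)).nullMeasurableSet) hanti ⟨0, measure_ne_top _ _⟩
  rw [hI, hnull] at ht
  obtain ⟨n, hn⟩ := (ht.eventually_le_const hε).exists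
  exact ⟨1 / ((n : ℝ) + 1), by positivity, hn⟩

lemma small_ball (e : EuclideanSpace ℝ (Fin d)) (he : ‖e‖ = 1) (ε : ENNReal) (hε : 0 < ε) (hεt : ε ≠ ⊤) :
    ∃ δ : ℝ, 0 < δ ∧ ∀ R : ℝ, 0 < R → ∀ X : Measure (EuclideanSpace ℝ (Fin d)), IsProbabilityMeasure X →
      X {x | ‖x‖ = R}ᶜ = 0 →
      (∀ T : EuclideanSpace ℝ (Fin d) ≃ₗᵢ[ℝ] EuclideanSpace ℝ (Fin d), X.map T = X) →
      ∀ v, ‖v‖ = 1 → X {x | |⟪v, x⟫| ≤ δ * R} ≤ ε := by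
  obtain ⟨δ, hδ, hq⟩ := bm_slab e he (ε * bm d Set.univ) (ENNReal.mul_pos hε.ne' bm_pos.ne')
  refine ⟨δ, hδ, ?_⟩
  intro R hR X _ hXR hX v hv
  set S : Set (EuclideanSpace ℝ (Fin d) × EuclideanSpace ℝ (Fin d)) := {z | |⟪z.1, z.2⟫| ≤ δ * R} with hS
  have hSm : MeasurableSet S := measurableSet_le (by fun_prop) (by fun_prop)
  have h1 : X {x | |⟪v, x⟫| ≤ δ * R} * bm d Set.univ ≤ ((bm d).prod X) S := by
    rw [Measure.prod_apply hSm, ← lintegral_const]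
    unfold bm
    apply setLIntegral_mono' Metric.isOpen_ball.measurableSet
    intro w hw
    have hw1 : ‖w‖ ≤ 1 := by simpa using (Metric.mem_ball.1 hw).le
    have h2 := law_set X hX w (‖w‖ • v) (by simp [norm_smul, hv]) (s := {t | |t| ≤ δ * R})
      (measurableSet_le (by fun_prop) (by fun_prop))
    change _ ≤ X {x | ⟪w, x⟫ ∈ {t : ℝ | |t| ≤ δ * R}}
    rw [h2]
    apply measure_mono
    intro x hx
    simp only [Set.mem_ofPred_eq] at hx ⊢
    rw [real_inner_smul_left, abs_mul, abs_norm]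
    exact (mul_le_of_le_one_left (abs_nonneg _) hw1).trans hx
  have h2 : ((bm d).prod X) S ≤ ε * bm d Set.univ := by
    rw [Measure.prod_apply_symm hSm]
    calc _ ≤ ∫⁻ x, (ε * bm d Set.univ) ∂X := by
          apply lintegral_mono_ae
          have : ∀ᵐ x ∂X, ‖x‖ = R := hXR
          filter_upwards [this] with x hx
          have h3 := law_set (bm d) bm_inv x (R • e) (by simp [norm_smul, he, hx, abs_of_pos hR]) (s := {t | |t| ≤ δ * R})
            (measurableSet_le (by fun_prop) (by fun_prop))
          refine le_trans (le_of_eq ?_) hq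
          have h4 : (fun w => (w, x)) ⁻¹' S = {w | ⟪x, w⟫ ∈ {t : ℝ | |t| ≤ δ * R}} := by
            ext w; simp [hS, real_inner_comm]
          rw [h4, h3]
          congr 1
          ext w
          simp only [Set.mem_ofPred_eq]
          rw [real_inner_smul_left, abs_mul, abs_of_pos hR, mul_comm δ R]
          exact mul_le_mul_iff_right₀ hR
      _ = _ := by simp
  exact (ENNReal.mul_le_mul_iff_left bm_pos.ne' (measure_ne_top _ _)).1 (h1.trans h2)

lemma hyper_null (R : ℝ) (hR : 0 < R) (X : Measure (EuclideanSpace ℝ (Fin d))) [IsProbabilityMeasure X]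
    (hXR : X {x | ‖x‖ = R}ᶜ = 0)
    (hX : ∀ T : EuclideanSpace ℝ (Fin d) ≃ₗᵢ[ℝ] EuclideanSpace ℝ (Fin d), X.map T = X)
    (v : EuclideanSpace ℝ (Fin d)) (hv : ‖v‖ = 1) : ∀ᵐ x ∂X, ⟪v, x⟫ ≠ 0 := by
  have : X {x | ⟪v, x⟫ = 0} = 0 := by
    apply le_antisymm _ (zero_le)
    apply le_of_forall_pos_le_add
    intro ε hε
    rw [zero_add]
    by_cases h : ε = ⊤
    · simp [h]
    obtain ⟨δ, hδ, hh⟩ := small_ball v hv ε hε h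
    refine le_trans (measure_mono ?_) (hh R hR X inferInstance hXR hX v hv)
    intro x hx
    simp only [Set.mem_ofPred_eq] at hx ⊢
    rw [hx, abs_zero]; positivity
  simpa [ae_iff] using this

end inv

lemma cauchy_unit (f : ℝ → ℝ) (h0 : ∀ a, 0 ≤ f a) (h1 : f 1 = 1)
    (hadd : ∀ a b, 0 ≤ a → 0 ≤ b → a + b ≤ 1 → f (a + b) = f a + f b) (c : ℝ) (hc0 : 0 ≤ c) (hc1 : c ≤ 1) :
    f c = c := by
  have hmono : ∀ a b, 0 ≤ a → a ≤ b → b ≤ 1 → f a ≤ f b := by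
    intro a b ha hab hb
    have := hadd a (b - a) ha (by linarith) (by linarith)
    rw [add_sub_cancel] at this
    linarith [h0 (b - a)]
  have hk : ∀ n : ℕ, 0 < n → ∀ k : ℕ, k ≤ n → f (k / n) = k * f (1 / n) := by
    intro n hn k
    have hnR : (0 : ℝ) < n := by exact_mod_cast hn
    induction k with
    | zero =>
      intro _
      have := hadd 0 0 le_rfl le_rfl (by norm_num)
      simp at this ⊢
      exact this
    | succ k ih =>
      intro hkn
      have hknR : ((k : ℝ) + 1) ≤ n := by exact_mod_cast hkn
      have := hadd (k / n) (1 / n) (by positivity) (by positivity) (by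
        rw [← add_div, div_le_one hnR]; exact hknR)
      rw [ih (by omega), ← add_div] at this
      push_cast
      rw [this]; ring
  have hk2 : ∀ n : ℕ, 0 < n → ∀ k : ℕ, k ≤ n → f (k / n) = k / n := by
    intro n hn k hkn
    have hnR : (0 : ℝ) < n := by exact_mod_cast hn
    have := hk n hn n le_rfl
    rw [div_self hnR.ne', h1] at this
    rw [hk n hn k hkn]
    field_simp
    nlinarith
  have key : ∀ n : ℕ, |f c - c| ≤ 1 / ((n : ℝ) + 1) := by
    intro n
    have hnR : (0 : ℝ) < (n : ℝ) + 1 := by positivity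
    set k := ⌊c * (n + 1)⌋₊ with hkdef
    have hle : (k : ℝ) ≤ c * (n + 1) := Nat.floor_le (by positivity)
    have hlt : c * (n + 1) < k + 1 := Nat.lt_floor_add_one _
    have hA : (k : ℝ) / (n + 1) ≤ c := by rwa [div_le_iff₀ hnR]
    have hB : c ≤ ((k : ℝ) + 1) / (n + 1) := by rw [le_div_iff₀ hnR]; exact hlt.le
    have hsum : ((k : ℝ) + 1) / (n + 1) = k / (n + 1) + 1 / (n + 1) := by ring
    have hkn : k ≤ n + 1 := by
      have : (k : ℝ) ≤ n + 1 := hle.trans (by nlinarith)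
      exact_mod_cast this
    have e1 := hk2 (n + 1) (by omega) k hkn
    push_cast at e1
    have e2 := hmono _ c (by positivity) hA hc1
    rw [e1] at e2
    have e3 : f c ≤ ((k : ℝ) + 1) / (n + 1) := by
      rcases Nat.lt_or_ge k (n + 1) with hltB | hge
      · have e4 := hk2 (n + 1) (by omega) (k + 1) (by omega)
        push_cast at e4
        rw [← e4]
        apply hmono _ _ hc0 hB
        rw [div_le_one hnR]
        exact_mod_cast hltB
      · have : f c ≤ 1 := h1 ▸ hmono c 1 hc0 hc1 le_rfl
        refine this.trans ?_
        rw [le_div_iff₀ hnR]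
        have : ((n : ℝ) + 1) ≤ k := by exact_mod_cast hge
        linarith
    rw [abs_le]
    constructor <;> linarith
  have := ge_of_tendsto' tendsto_one_div_add_atTop_nhds_zero_nat key
  have h2 : f c - c = 0 := by simpa using this
  linarith

section angle
variable {d : ℕ}

/-- unit vector at angle `t` -/
noncomputable def uv (e f : EuclideanSpace ℝ (Fin d)) (t : ℝ) : EuclideanSpace ℝ (Fin d) :=
  Real.cos t • e + Real.sin t • f

lemma uv_inner (e f : EuclideanSpace ℝ (Fin d)) (he : ‖e‖ = 1) (hf : ‖f‖ = 1) (hef : ⟪e, f⟫ = 0) (s t : ℝ) :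
    ⟪uv e f s, uv e f t⟫ = Real.cos (s - t) := by
  unfold uv
  have hfe : ⟪f, e⟫ = 0 := by rw [real_inner_comm]; exact hef
  simp only [inner_add_left, inner_add_right, real_inner_smul_left, real_inner_smul_right, hef, hfe,
    real_inner_self_eq_norm_sq, he, hf, Real.cos_sub]
  ring

lemma uv_norm (e f : EuclideanSpace ℝ (Fin d)) (he : ‖e‖ = 1) (hf : ‖f‖ = 1) (hef : ⟪e, f⟫ = 0) (s : ℝ) :
    ‖uv e f s‖ = 1 := by
  have := uv_inner e f he hf hef s s
  rw [real_inner_self_eq_norm_sq, sub_self, Real.cos_zero] at this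
  nlinarith [norm_nonneg (uv e f s)]

/-- disagreement set -/
def dis (v w : EuclideanSpace ℝ (Fin d)) : Set (EuclideanSpace ℝ (Fin d)) :=
  {x | sgn ⟪w, x⟫ ≠ sgn ⟪v, x⟫}

lemma dis_meas (v w : EuclideanSpace ℝ (Fin d)) : MeasurableSet (dis v w) := by
  have h1 : Measurable fun x : EuclideanSpace ℝ (Fin d) => sgn ⟪w, x⟫ := measurable_sgn.comp (by fun_prop)
  have h2 : Measurable fun x : EuclideanSpace ℝ (Fin d) => sgn ⟪v, x⟫ := measurable_sgn.comp (by fun_prop)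
  exact (measurableSet_eq_fun h1 h2).compl

lemma dis_shift (X : Measure (EuclideanSpace ℝ (Fin d)))
    (hX : ∀ T : EuclideanSpace ℝ (Fin d) ≃ₗᵢ[ℝ] EuclideanSpace ℝ (Fin d), X.map T = X)
    (e f : EuclideanSpace ℝ (Fin d)) (he : ‖e‖ = 1) (hf : ‖f‖ = 1) (hef : ⟪e, f⟫ = 0) (a b : ℝ) :
    X (dis (uv e f a) (uv e f (a + b))) = X (dis (uv e f 0) (uv e f b)) := by
  set w := uv e f ((a + b) / 2 + Real.pi / 2) with hw
  set T := (ℝ ∙ w)ᗮ.reflection with hT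
  have hTu : ∀ s, T (uv e f s) = uv e f (a + b - s) := by
    intro s
    rw [hT, Submodule.reflection_orthogonal_apply, Submodule.reflection_singleton_apply]
    rw [hw, uv_inner e f he hf hef, uv_norm e f he hf hef]
    have h1 : (a + b) / 2 + Real.pi / 2 - s = ((a + b) / 2 - s) + Real.pi / 2 := by ring
    rw [h1, Real.cos_add_pi_div_two]
    unfold uv
    rw [Real.cos_add_pi_div_two, Real.sin_add_pi_div_two]
    set m := (a + b) / 2 with hm
    have h2 : a + b - s = m + (m - s) := by rw [hm]; ring
    have h3 : s = m - (m - s) := by ring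
    have c1 : Real.cos (a + b - s) = Real.cos s - 2 * Real.sin (m - s) * Real.sin m := by
      rw [h2, Real.cos_add]
      conv_rhs => rw [h3, Real.cos_sub]
      ring_nf
    have c2 : Real.sin (a + b - s) = Real.sin s + 2 * Real.sin (m - s) * Real.cos m := by
      rw [h2, Real.sin_add]
      conv_rhs => rw [h3, Real.sin_sub]
      ring_nf
    rw [c1, c2]
    simp only [RCLike.ofReal_real_eq_id, id]
    module
  have hc : ∀ s x, ⟪uv e f s, T x⟫ = ⟪uv e f (a + b - s), x⟫ := by
    intro s x
    rw [← hTu s, ← T.inner_map_map (uv e f s) (T x)]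
    congr 1
    exact Submodule.reflection_reflection _ x
  conv_lhs => rw [← hX T]
  rw [Measure.map_apply T.continuous.measurable (dis_meas _ _)]
  congr 1
  ext x
  simp only [dis, Set.mem_preimage, Set.mem_ofPred_eq, hc]
  rw [show a + b - (a + b) = 0 by ring, show a + b - a = b by ring]
  exact ne_comm

lemma dis_add (R : ℝ) (hR : 0 < R) (X : Measure (EuclideanSpace ℝ (Fin d))) [IsProbabilityMeasure X]
    (hXR : X {x | ‖x‖ = R}ᶜ = 0)
    (hX : ∀ T : EuclideanSpace ℝ (Fin d) ≃ₗᵢ[ℝ] EuclideanSpace ℝ (Fin d), X.map T = X)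
    (e f : EuclideanSpace ℝ (Fin d)) (he : ‖e‖ = 1) (hf : ‖f‖ = 1) (hef : ⟪e, f⟫ = 0) (a b : ℝ)
    (ha : 0 ≤ a) (hb : 0 ≤ b) (hab : a + b ≤ Real.pi) :
    X.real (dis (uv e f 0) (uv e f (a + b))) =
      X.real (dis (uv e f 0) (uv e f a)) + X.real (dis (uv e f 0) (uv e f b)) := by
  have h1 : X.real (dis (uv e f 0) (uv e f b)) = X.real (dis (uv e f a) (uv e f (a + b))) := by
    simp only [measureReal_def]
    rw [dis_shift X hX e f he hf hef]
  rw [h1]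
  have key : ∀ᵐ x ∂X, ¬ (x ∈ dis (uv e f 0) (uv e f a) ∧ x ∈ dis (uv e f a) (uv e f (a + b))) := by
    filter_upwards [hyper_null R hR X hXR hX (uv e f 0) (uv_norm e f he hf hef 0)] with x hx0
    rintro ⟨h2, h3⟩
    simp only [dis, Set.mem_ofPred_eq] at h2 h3
    have hid : Real.sin (a + b) * ⟪uv e f a, x⟫ =
        Real.sin b * ⟪uv e f 0, x⟫ + Real.sin a * ⟪uv e f (a + b), x⟫ := by
      simp only [uv, inner_add_left, real_inner_smul_left, Real.sin_add, Real.cos_add, Real.cos_zero, Real.sin_zero]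
      linear_combination (Real.sin b * ⟪e, x⟫) * Real.sin_sq_add_cos_sq a
    have sa : 0 ≤ Real.sin a := Real.sin_nonneg_of_nonneg_of_le_pi ha (by linarith)
    have sb : 0 ≤ Real.sin b := Real.sin_nonneg_of_nonneg_of_le_pi hb (by linarith)
    rcases hab.lt_or_eq with hlt | heq
    · by_cases hz : a + b = 0
      · have : a = 0 := by linarith
        subst this
        exact h2 rfl
      have sab : 0 < Real.sin (a + b) := Real.sin_pos_of_pos_of_lt_pi (lt_of_le_of_ne (by linarith) (Ne.symm hz)) hlt
      unfold sgn at h2 h3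
      split_ifs at h2 h3 <;> simp_all
      · nlinarith
      · rename_i p q r
        have hp : 0 < ⟪uv e f 0, x⟫ := by assumption
        have hn : ⟪uv e f a, x⟫ ≤ 0 := by assumption
        have hp2 : 0 < ⟪uv e f (a + b), x⟫ := by assumption
        have z1 : Real.sin b * ⟪uv e f 0, x⟫ = 0 := by nlinarith [mul_nonneg sb hp.le, mul_nonneg sa hp2.le]
        have z2 : Real.sin a * ⟪uv e f (a + b), x⟫ = 0 := by nlinarith [mul_nonneg sb hp.le, mul_nonneg sa hp2.le]
        have z3 : Real.sin b = 0 := by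
          rcases mul_eq_zero.1 z1 with h | h
          · exact h
          · linarith
        have z4 : Real.sin a = 0 := by
          rcases mul_eq_zero.1 z2 with h | h
          · exact h
          · linarith
        rw [Real.sin_add, z3, z4] at sab
        simp at sab
    · have h5 : ⟪uv e f (a + b), x⟫ = - ⟪uv e f 0, x⟫ := by
        rw [heq]; simp [uv]
      rw [h5] at h3
      unfold sgn at h2 h3
      rcases lt_or_gt_of_ne hx0 with h | h
      · have h6 : ¬ (0 < ⟪uv e f 0, x⟫) := not_lt.2 h.le
        have h7 : 0 < - ⟪uv e f 0, x⟫ := by linarith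
        rw [if_neg h6] at h2
        rw [if_pos h7] at h3
        split_ifs at h2 h3
        · exact h3 rfl
        · exact h2 rfl
      · have h7 : ¬ 0 < - ⟪uv e f 0, x⟫ := by linarith
        rw [if_pos h] at h2
        rw [if_neg h7] at h3
        split_ifs at h2 h3
        · exact h2 rfl
        · exact h3 rfl
  have hdj : AEDisjoint X (dis (uv e f 0) (uv e f a)) (dis (uv e f a) (uv e f (a + b))) := by
    unfold AEDisjoint
    rw [measure_eq_zero_iff_ae_notMem]
    exact key
  rw [← measureReal_union₀ (dis_meas _ _).nullMeasurableSet hdj]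
  apply measureReal_congr
  filter_upwards [key] with x hx
  apply propext
  change x ∈ dis _ _ ↔ (x ∈ dis _ _ ∨ x ∈ dis _ _)
  simp only [dis, Set.mem_ofPred_eq] at hx ⊢
  have hne : (1 : ℝ) ≠ -1 := by norm_num
  rcases sgn_cases ⟪uv e f 0, x⟫ with h | h <;> rcases sgn_cases ⟪uv e f a, x⟫ with hB2 | hB2 <;>
    rcases sgn_cases ⟪uv e f (a + b), x⟫ with hC | hC <;> rw [h, hB2, hC] at hx <;> rw [h, hB2, hC] <;>
    simp [hne, hne.symm] at hx ⊢

lemma dis_angle (R : ℝ) (hR : 0 < R) (X : Measure (EuclideanSpace ℝ (Fin d))) [IsProbabilityMeasure X]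
    (hXR : X {x | ‖x‖ = R}ᶜ = 0)
    (hX : ∀ T : EuclideanSpace ℝ (Fin d) ≃ₗᵢ[ℝ] EuclideanSpace ℝ (Fin d), X.map T = X)
    (e f : EuclideanSpace ℝ (Fin d)) (he : ‖e‖ = 1) (hf : ‖f‖ = 1) (hef : ⟪e, f⟫ = 0) (c : ℝ)
    (h0 : 0 ≤ c) (h1 : c ≤ 1) :
    X.real (dis (uv e f 0) (uv e f (Real.pi * c))) = c := by
  have hpi := Real.pi_pos
  refine cauchy_unit (fun c => X.real (dis (uv e f 0) (uv e f (Real.pi * c)))) (fun _ => measureReal_nonneg) ?_ ?_ c h0 h1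
  · have : X (dis (uv e f 0) (uv e f (Real.pi * 1))) = 1 := by
      rw [prob_compl_eq_zero_iff (dis_meas _ _) |>.symm, measure_eq_zero_iff_ae_notMem]
      filter_upwards [hyper_null R hR X hXR hX (uv e f 0) (uv_norm e f he hf hef 0)] with x hx0
      have h5 : ⟪uv e f (Real.pi * 1), x⟫ = - ⟪uv e f 0, x⟫ := by
        simp [uv]
      simp only [Set.mem_compl_iff, not_not, dis, Set.mem_ofPred_eq, h5]
      unfold sgn
      rcases lt_or_gt_of_ne hx0 with h | h
      · rw [if_pos (by linarith), if_neg (by linarith)]; norm_num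
      · rw [if_neg (by linarith), if_pos (by linarith)]; norm_num
    simp only [measureReal_def, this, ENNReal.toReal_one]
  · intro a b ha hb hab
    have := dis_add R hR X hXR hX e f he hf hef (Real.pi * a) (Real.pi * b) (by positivity) (by positivity)
      (by nlinarith)
    rw [← mul_add] at this
    exact this

end angle

/-- logistic loss -/
noncomputable def ell (t : ℝ) : ℝ := Real.log (1 + Real.exp (-t))

lemma ell_cont : Continuous ell := by
  unfold ell
  refine Continuous.log (by fun_prop) (fun t => by positivity)

lemma ell_anti : StrictAnti ell := by
  intro a b hab
  unfold ell
  apply Real.log_lt_log (by positivity)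
  have : Real.exp (-b) < Real.exp (-a) := Real.exp_lt_exp.2 (by linarith)
  linarith

lemma ell_nonneg (t : ℝ) : 0 ≤ ell t := by
  unfold ell
  apply Real.log_nonneg
  linarith [Real.exp_pos (-t)]

lemma ell_neg (t : ℝ) : ell (-t) = ell t + t := by
  unfold ell
  rw [neg_neg]
  have : 1 + Real.exp t = (1 + Real.exp (-t)) * Real.exp t := by
    rw [add_mul, ← Real.exp_add]; simp [add_comm]
  rw [this, Real.log_mul (by positivity) (by positivity), Real.log_exp]

section fin
variable {d : ℕ}

lemma ell_int (R : ℝ) (X : Measure (EuclideanSpace ℝ (Fin d))) [IsProbabilityMeasure X]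
    (hXR : X {x | ‖x‖ = R}ᶜ = 0) (θ : EuclideanSpace ℝ (Fin d)) (hθ : ‖θ‖ ≤ 1)
    (g : EuclideanSpace ℝ (Fin d) → ℝ) (hg : Measurable g) (hgb : ∀ x, |g x| ≤ |⟪θ, x⟫|) :
    Integrable (fun x => ell (g x)) X := by
  apply Integrable.of_bound (C := ell (-R)) (ell_cont.measurable.comp hg).aestronglyMeasurable
  have : ∀ᵐ x ∂X, ‖x‖ = R := hXR
  filter_upwards [this] with x hx
  change ‖ell (g x)‖ ≤ _
  rw [Real.norm_of_nonneg (ell_nonneg _)]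
  apply ell_anti.antitone
  have h1 : |⟪θ, x⟫| ≤ ‖θ‖ * ‖x‖ := abs_real_inner_le_norm _ _
  have h2 : ‖θ‖ * ‖x‖ ≤ R := by rw [hx]; have := norm_nonneg x; nlinarith
  have := neg_abs_le (g x)
  linarith [hgb x]

lemma final (R : ℝ) (hR : 0 < R) (X : Measure (EuclideanSpace ℝ (Fin d))) [IsProbabilityMeasure X]
    (hXR : X {x | ‖x‖ = R}ᶜ = 0)
    (hX : ∀ T : EuclideanSpace ℝ (Fin d) ≃ₗᵢ[ℝ] EuclideanSpace ℝ (Fin d), X.map T = X)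
    (a b θ : EuclideanSpace ℝ (Fin d)) (ha : ‖a‖ = 1) (hb : ‖b‖ = 1) (hθ : ‖θ‖ ≤ 1) (c : ℝ)
    (hdis : X.real (dis a b) = c)
    (hsm : ∀ v : EuclideanSpace ℝ (Fin d), ‖v‖ = 1 → X.real {x | |⟪v, x⟫| ≤ 1} ≤ c / 2)
    (hmin : ∫ x, ell (sgn ⟪b, x⟫ * ⟪θ, x⟫) ∂X ≤ ∫ x, ell (sgn ⟪b, x⟫ * ⟪b, x⟫) ∂X) :
    ∫ x, ell (sgn ⟪a, x⟫ * ⟪a, x⟫) ∂X + c / 2 ≤ ∫ x, ell (sgn ⟪a, x⟫ * ⟪θ, x⟫) ∂X := by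
  have hms : ∀ v : EuclideanSpace ℝ (Fin d), Measurable fun x => sgn ⟪v, x⟫ :=
    fun v => measurable_sgn.comp (by fun_prop)
  have hmi : ∀ v : EuclideanSpace ℝ (Fin d), Measurable fun x => ⟪v, x⟫ := fun v => by fun_prop
  have hmabs : Measurable fun t : ℝ => ell |t| := ell_cont.measurable.comp (by fun_prop)
  simp only [sgn_mul_self] at hmin ⊢
  have hI1 : ∀ v : EuclideanSpace ℝ (Fin d), Integrable (fun x => ell (sgn ⟪v, x⟫ * ⟪θ, x⟫)) X := by
    intro v
    apply ell_int R X hXR θ hθ _ ((hms v).mul (hmi θ))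
    intro x
    change |sgn ⟪v, x⟫ * ⟪θ, x⟫| ≤ _
    rw [abs_mul, abs_sgn, one_mul]
  have hI2 : ∀ v : EuclideanSpace ℝ (Fin d), ‖v‖ ≤ 1 → Integrable (fun x => ell |⟪v, x⟫|) X := by
    intro v hv
    apply ell_int R X hXR v hv _ (by fun_prop)
    intro x
    rw [abs_abs]
  have hab := law_int X hX a b (by rw [ha, hb]) hmabs
  have hθb := law_int X hX θ (‖θ‖ • b) (by simp [norm_smul, hb]) hmabs
  have hrb : ‖‖θ‖ • b‖ ≤ 1 := by simpa [norm_smul, hb] using hθ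
  have le1 : ∀ x, ell |⟪θ, x⟫| ≤ ell (sgn ⟪b, x⟫ * ⟪θ, x⟫) := by
    intro x
    apply ell_anti.antitone
    refine (le_abs_self _).trans ?_
    rw [abs_mul, abs_sgn, one_mul]
  have le2 : ∀ x, ell |⟪b, x⟫| ≤ ell |⟪‖θ‖ • b, x⟫| := by
    intro x
    apply ell_anti.antitone
    rw [real_inner_smul_left, abs_mul, abs_norm]
    exact mul_le_of_le_one_left (abs_nonneg _) hθ
  have i1 := integral_mono (hI2 θ hθ) (hI1 b) le1
  have i2 := integral_mono (hI2 b hb.le) (hI2 _ hrb) le2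
  have q1 := (integral_eq_iff_of_ae_le (hI2 θ hθ) (hI1 b) (Filter.Eventually.of_forall le1)).1 (by linarith)
  have q2 := (integral_eq_iff_of_ae_le (hI2 b hb.le) (hI2 _ hrb) (Filter.Eventually.of_forall le2)).1 (by linarith)
  have hθ1 : ‖θ‖ = 1 := by
    have hne := hyper_null R hR X hXR hX b hb
    obtain ⟨x, hx1, hx2⟩ := (q2.and hne).exists
    have := ell_anti.injective hx1
    rw [real_inner_smul_left, abs_mul, abs_norm] at this
    have hp : 0 < |⟪b, x⟫| := abs_pos.2 hx2
    nlinarith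
  set B := dis a b \ {x | |⟪θ, x⟫| ≤ 1} with hB
  have hBm : MeasurableSet B := (dis_meas a b).diff (measurableSet_le (by fun_prop) (by fun_prop))
  have hBc : c / 2 ≤ X.real B := by
    have h1 := le_measureReal_sdiff (μ := X) (s₁ := dis a b) (s₂ := {x | |⟪θ, x⟫| ≤ 1})
    have := hsm θ hθ1
    rw [hdis] at h1
    linarith
  have hfin : ∫ x, B.indicator 1 x ∂X ≤ ∫ x, (ell (sgn ⟪a, x⟫ * ⟪θ, x⟫) - ell (sgn ⟪b, x⟫ * ⟪θ, x⟫)) ∂X := by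
    apply integral_mono_ae ((integrable_const (1:ℝ)).indicator hBm) ((hI1 a).sub (hI1 b))
    filter_upwards [q1] with x hx
    have hs := ell_anti.injective hx
    change _ ≤ ell (sgn ⟪a, x⟫ * ⟪θ, x⟫) - ell (sgn ⟪b, x⟫ * ⟪θ, x⟫)
    by_cases hd : sgn ⟪b, x⟫ = sgn ⟪a, x⟫
    · have : x ∉ B := fun h => h.1 hd
      simp [this, hd]
    · have hneg : sgn ⟪a, x⟫ = - sgn ⟪b, x⟫ := by
        rcases sgn_cases ⟪a, x⟫ with h | h <;> rcases sgn_cases ⟪b, x⟫ with hB2 | hB2 <;> simp_all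
      simp only [hneg, neg_mul, ell_neg, ← hs]
      rw [add_sub_cancel_left]
      by_cases hxB : x ∈ B
      · have : ¬ |⟪θ, x⟫| ≤ 1 := hxB.2
        simp only [hxB, Set.indicator_of_mem, Pi.one_apply]
        linarith
      · simp [hxB]
  rw [integral_indicator_one hBm, integral_sub (hI1 a) (hI1 b)] at hfin
  linarith

end fin

/-- **Minimizing the naive (unweighted) objective over noisy labels fails.**

Fix `c ∈ [0,1]` and dimension `d ≥ 2`.  There exist a radius `R > 0`, a unit vector `θ*`,
and a unit vector `θ̃` with angle `πc` to `θ*` such that for `X` the uniform (i.e.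
rotation-invariant) probability distribution on the sphere of radius `R` in `ℝ^d`, the clean
distribution `P` labeling `x ∼ X` by `sign(θ*·x)` and the noisy distribution `D` labeling it
by `sign(θ̃·x)` satisfy:
(1) the `x`-marginals of `P` and `D` are `X`;
(2) the noise level is `Pr_{(x,y)∼D}[y ≠ sign(θ*·x)] = c`;
(3) any minimizer `θ̂` of the naive objective `Rnaive θ = E_{(x,y)∼D}[log(1+e^{−y θ·x})]`
over the unit ball has clean risk `R(θ̂) ≥ inf_{‖θ‖≤1} R(θ) + c/2`, where
`R θ = E_{x∼X}[log(1+e^{−sign(θ*·x) θ·x})]`. -/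
theorem naive_objective_fails
    (c : ℝ) (hc : 0 ≤ c ∧ c ≤ 1) (d : ℕ) (hd : 2 ≤ d) :
    ∃ (R : ℝ) (θstar θtil : EuclideanSpace ℝ (Fin d)),
      0 < R ∧ ‖θstar‖ = 1 ∧ ‖θtil‖ = 1 ∧
      Real.arccos ⟪θstar, θtil⟫ = Real.pi * c ∧
      ∀ (X : Measure (EuclideanSpace ℝ (Fin d))), IsProbabilityMeasure X →
        X {x | ‖x‖ = R}ᶜ = 0 →
        (∀ T : EuclideanSpace ℝ (Fin d) ≃ₗᵢ[ℝ] EuclideanSpace ℝ (Fin d),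
          X.map T = X) →
        ∀ (P D : Measure ((EuclideanSpace ℝ (Fin d)) × ℝ)),
          P = X.map (fun x => (x, sgn ⟪θstar, x⟫)) →
          D = X.map (fun x => (x, sgn ⟪θtil, x⟫)) →
          -- (1) the x-marginals of `P` and `D` coincide with `X`
          (P.map Prod.fst = X ∧ D.map Prod.fst = X) ∧
          -- (2) the noise level is exactly `c`
          D {z | z.2 ≠ sgn ⟪θstar, z.1⟫} = ENNReal.ofReal c ∧
          -- (3) any constrained minimizer of the naive objective generalizes badly
          (∀ θhat : EuclideanSpace ℝ (Fin d), ‖θhat‖ ≤ 1 →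
            (∀ θ : EuclideanSpace ℝ (Fin d), ‖θ‖ ≤ 1 →
              (∫ z, Real.log (1 + Real.exp (-(z.2 * ⟪θhat, z.1⟫))) ∂D)
                ≤ ∫ z, Real.log (1 + Real.exp (-(z.2 * ⟪θ, z.1⟫))) ∂D) →
            sInf ((fun θ : EuclideanSpace ℝ (Fin d) =>
                ∫ x, Real.log (1 + Real.exp (-(sgn ⟪θstar, x⟫ * ⟪θ, x⟫))) ∂X) ''
                {θ | ‖θ‖ ≤ 1}) + c / 2
              ≤ ∫ x, Real.log (1 + Real.exp (-(sgn ⟪θstar, x⟫ * ⟪θhat, x⟫))) ∂X) := by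
  have hdpos : 0 < d := by omega
  set e : EuclideanSpace ℝ (Fin d) := EuclideanSpace.single ⟨0, by omega⟩ 1 with hedef
  set f : EuclideanSpace ℝ (Fin d) := EuclideanSpace.single ⟨1, by omega⟩ 1 with hfdef
  have he : ‖e‖ = 1 := by simp [hedef]
  have hf : ‖f‖ = 1 := by simp [hfdef]
  have hef : ⟪e, f⟫ = 0 := by
    simp [hedef, hfdef, EuclideanSpace.inner_single_left]
  obtain ⟨hc0, hc1⟩ := hc
  have hRex : ∃ R : ℝ, 0 < R ∧ (0 < c → ∀ X : Measure (EuclideanSpace ℝ (Fin d)),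
      IsProbabilityMeasure X → X {x | ‖x‖ = R}ᶜ = 0 →
      (∀ T : EuclideanSpace ℝ (Fin d) ≃ₗᵢ[ℝ] EuclideanSpace ℝ (Fin d), X.map T = X) →
      ∀ v : EuclideanSpace ℝ (Fin d), ‖v‖ = 1 → X.real {x | |⟪v, x⟫| ≤ 1} ≤ c / 2) := by
    by_cases hcp : 0 < c
    · obtain ⟨δ, hδ, h⟩ := small_ball e he (ENNReal.ofReal (c / 2)) (by simpa using hcp) ENNReal.ofReal_ne_top
      refine ⟨1 / δ, by positivity, fun _ X hXp hXR hX v hv => ?_⟩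
      have := h (1 / δ) (by positivity) X hXp hXR hX v hv
      rw [mul_one_div_cancel hδ.ne'] at this
      exact ENNReal.toReal_le_of_le_ofReal (by linarith) this
    · exact ⟨1, one_pos, fun h => absurd h hcp⟩
  obtain ⟨R, hR, hsm⟩ := hRex
  have hpi := Real.pi_pos
  refine ⟨R, uv e f 0, uv e f (Real.pi * c), hR, uv_norm e f he hf hef _, uv_norm e f he hf hef _, ?_, ?_⟩
  · rw [uv_inner e f he hf hef, zero_sub, Real.cos_neg, Real.arccos_cos (by positivity) (by nlinarith)]
  intro X hXp hXR hX P D hP hD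
  have ha := uv_norm e f he hf hef 0
  have hb := uv_norm e f he hf hef (Real.pi * c)
  have hdis := dis_angle R hR X hXR hX e f he hf hef c hc0 hc1
  set a := uv e f 0 with hadef
  set b := uv e f (Real.pi * c) with hbdef
  have hms : ∀ v : EuclideanSpace ℝ (Fin d), Measurable fun x => sgn ⟪v, x⟫ :=
    fun v => measurable_sgn.comp (by fun_prop)
  have hmp : ∀ v : EuclideanSpace ℝ (Fin d), Measurable fun x => (x, sgn ⟪v, x⟫) :=
    fun v => measurable_id.prodMk (hms v)
  have hmar : ∀ v : EuclideanSpace ℝ (Fin d), (X.map fun x => (x, sgn ⟪v, x⟫)).map Prod.fst = X := by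
    intro v
    rw [Measure.map_map measurable_fst (hmp v)]
    exact Measure.map_id
  refine ⟨⟨hP ▸ hmar a, hD ▸ hmar b⟩, ?_, ?_⟩
  · have hm : MeasurableSet {z : EuclideanSpace ℝ (Fin d) × ℝ | z.2 ≠ sgn ⟪a, z.1⟫} :=
      (measurableSet_eq_fun measurable_snd ((hms a).comp measurable_fst)).compl
    rw [hD, Measure.map_apply (hmp b) hm]
    change X (dis a b) = _
    rw [← hdis, measureReal_def, ENNReal.ofReal_toReal (measure_ne_top _ _)]
  · intro θ hθ hmin
    have hint : ∀ v : EuclideanSpace ℝ (Fin d), (∫ z, Real.log (1 + Real.exp (-(z.2 * ⟪v, z.1⟫))) ∂D)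
        = ∫ x, ell (sgn ⟪b, x⟫ * ⟪v, x⟫) ∂X := by
      intro v
      rw [hD, integral_map (hmp b).aemeasurable]
      · rfl
      · have : Measurable fun z : EuclideanSpace ℝ (Fin d) × ℝ => ell (z.2 * ⟪v, z.1⟫) :=
          ell_cont.measurable.comp (by fun_prop)
        exact this.aestronglyMeasurable
    have hm := hmin b hb.le
    rw [hint, hint] at hm
    have hbdd : BddBelow ((fun θ : EuclideanSpace ℝ (Fin d) =>
                ∫ x, Real.log (1 + Real.exp (-(sgn ⟪a, x⟫ * ⟪θ, x⟫))) ∂X) ''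
                {θ | ‖θ‖ ≤ 1}) := by
      refine ⟨0, ?_⟩
      rintro _ ⟨v, -, rfl⟩
      exact integral_nonneg fun x => ell_nonneg _
    rcases hc0.eq_or_lt with h0 | hcp
    · have := csInf_le hbdd ⟨θ, hθ, rfl⟩
      rw [← h0, zero_div, add_zero]
      exact this
    · have h1 := csInf_le hbdd ⟨a, ha.le, rfl⟩
      have h2 := final R hR X hXR hX a b θ ha hb hθ c hdis (hsm hcp X hXp hXR hX) hm
      exact (add_le_add_left h1 _).trans h2
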